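/- Let H = (X,Y,E) be a complete bipartite r-uniform hypergraph with |X| = |Y| = r and r ≥ 2. Then the total edge-domatic number of H equals |E|/2, i.e., ed_t(H) = |E|/2. -/

import Mathlib

open Finset

/-- Two vertices of a hypergraph with edge set `E` are adjacent if they are distinct
and some hyperedge contains both of them. -/
def HypVAdj {V : Type*} (E : Finset (Finset V)) (x y : V) : Prop :=
  x ≠ y ∧ ∃ e ∈ E, x ∈ e ∧ y ∈ e

/-- A dominating set: every vertex outside `D` is adjacent to some vertex of `D`. -/
def IsDominatingSet {V : Type*} (E : Finset (Finset V)) (D : Finset V) : Prop :=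
  ∀ x : V, x ∉ D → ∃ y ∈ D, HypVAdj E x y

/-- A total dominating set: every vertex is adjacent to some vertex of `D`. -/
def IsTotalDominatingSet {V : Type*} (E : Finset (Finset V)) (D : Finset V) : Prop :=
  ∀ x : V, ∃ y ∈ D, HypVAdj E x y

/-- A partition of the full vertex set into `k` dominating sets. -/
def IsDomaticPartition {V : Type*} [Fintype V] [DecidableEq V] (E : Finset (Finset V))
    {k : ℕ} (C : Fin k → Finset V) : Prop :=
  (∀ i j : Fin k, i ≠ j → Disjoint (C i) (C j)) ∧
  (Finset.univ.biUnion C = Finset.univ) ∧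
  (∀ i, IsDominatingSet E (C i))

/-- A partition of the full vertex set into `k` total dominating sets. -/
def IsTotalDomaticPartition {V : Type*} [Fintype V] [DecidableEq V] (E : Finset (Finset V))
    {k : ℕ} (C : Fin k → Finset V) : Prop :=
  (∀ i j : Fin k, i ≠ j → Disjoint (C i) (C j)) ∧
  (Finset.univ.biUnion C = Finset.univ) ∧
  (∀ i, IsTotalDominatingSet E (C i))

/-- Two hyperedges are adjacent if they are distinct and share at least one vertex. -/
def HypEAdj {V : Type*} [DecidableEq V] (e f : Finset V) : Prop :=
  e ≠ f ∧ (e ∩ f).Nonempty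

/-- An edge-dominating set: a subset `F ⊆ E` such that every hyperedge not in `F`
is adjacent to some hyperedge of `F`. -/
def IsEdgeDominatingSet {V : Type*} [DecidableEq V] (E F : Finset (Finset V)) : Prop :=
  F ⊆ E ∧ ∀ e ∈ E, e ∉ F → ∃ f ∈ F, HypEAdj e f

/-- A total edge-dominating set: a subset `F ⊆ E` such that every hyperedge of `E`
is adjacent to some hyperedge of `F`. -/
def IsTotalEdgeDominatingSet {V : Type*} [DecidableEq V] (E F : Finset (Finset V)) : Prop :=
  F ⊆ E ∧ ∀ e ∈ E, ∃ f ∈ F, HypEAdj e f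

/-- A partition of the edge set `E` into `k` edge-dominating sets. -/
def IsEdgeDomaticPartition {V : Type*} [DecidableEq V] (E : Finset (Finset V))
    {k : ℕ} (C : Fin k → Finset (Finset V)) : Prop :=
  (∀ i j : Fin k, i ≠ j → Disjoint (C i) (C j)) ∧
  (Finset.univ.biUnion C = E) ∧
  (∀ i, IsEdgeDominatingSet E (C i))

/-- A partition of the edge set `E` into `k` total edge-dominating sets. -/
def IsTotalEdgeDomaticPartition {V : Type*} [DecidableEq V] (E : Finset (Finset V))
    {k : ℕ} (C : Fin k → Finset (Finset V)) : Prop :=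
  (∀ i j : Fin k, i ≠ j → Disjoint (C i) (C j)) ∧
  (Finset.univ.biUnion C = E) ∧
  (∀ i, IsTotalEdgeDominatingSet E (C i))

/-- Edge set of the complete `r`-uniform hypergraph on the vertex type `V`:
all `r`-element subsets of `V`. -/
def completeEdges (V : Type*) [Fintype V] [DecidableEq V] (r : ℕ) : Finset (Finset V) :=
  Finset.powersetCard r (Finset.univ : Finset V)

/-- Edge set of the complete bipartite `r`-uniform hypergraph with parts `X` and `Y`:
all `r`-element subsets of `X ∪ Y` meeting both `X` and `Y`. -/
def bipEdges {V : Type*} [DecidableEq V] (X Y : Finset V) (r : ℕ) : Finset (Finset V) :=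
  (Finset.powersetCard r (X ∪ Y)).filter fun e => (e ∩ X).Nonempty ∧ (e ∩ Y).Nonempty

section Halves

variable {V : Type*} [Fintype V] [DecidableEq V] {r : ℕ}

theorem hypEAdj_of_ne_of_ne_compl {e f : Finset V} (hV : Fintype.card V = 2 * r)
    (he : e.card = r) (hf : f.card = r) (hne : e ≠ f) (hnc : e ≠ fᶜ) : HypEAdj e f := by
  refine ⟨hne, ?_⟩
  by_contra h
  rw [not_nonempty_iff_eq_empty, ← disjoint_iff_inter_eq_empty] at h
  refine hnc (eq_of_subset_of_card_le (subset_compl_iff_disjoint_right.2 h) ?_)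
  rw [card_compl]
  omega

/-- A pair of distinct, non-complementary halves is adjacent to every half. -/
theorem isTotalEdgeDominatingSet_pair {E : Finset (Finset V)} {a b : Finset V}
    (hV : Fintype.card V = 2 * r) (hE : ∀ e ∈ E, e.card = r)
    (ha : a ∈ E) (hb : b ∈ E) (hab : a ≠ b) (hnc : a ≠ bᶜ) :
    IsTotalEdgeDominatingSet E {a, b} := by
  refine ⟨by simp [insert_subset_iff, ha, hb], fun e he => ?_⟩
  by_cases h : e ≠ a ∧ e ≠ aᶜ
  · exact ⟨a, by simp, hypEAdj_of_ne_of_ne_compl hV (hE e he) (hE a ha) h.1 h.2⟩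
  · refine ⟨b, by simp, hypEAdj_of_ne_of_ne_compl hV (hE e he) (hE b hb) ?_ ?_⟩ <;>
    · rintro rfl
      simp_all [eq_comm]

end Halves

section TotalEdgeDomatic

variable {V : Type*} [DecidableEq V] {E : Finset (Finset V)}

theorem IsTotalEdgeDominatingSet.two_le_card {F : Finset (Finset V)}
    (hE : E.Nonempty) (hF : IsTotalEdgeDominatingSet E F) : 2 ≤ F.card := by
  obtain ⟨e, he⟩ := hE
  obtain ⟨f, hf, -⟩ := hF.2 e he
  obtain ⟨g, hg, hfg, -⟩ := hF.2 f (hF.1 hf)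
  exact one_lt_card.2 ⟨f, hf, g, hg, hfg⟩

theorem IsTotalEdgeDomaticPartition.le_card_div_two {k : ℕ} {C : Fin k → Finset (Finset V)}
    (hE : E.Nonempty) (hC : IsTotalEdgeDomaticPartition E C) : k ≤ E.card / 2 := by
  obtain ⟨hd, hU, hdom⟩ := hC
  have hcard : E.card = ∑ i, (C i).card := by
    rw [← hU, card_biUnion fun i _ j _ hij => hd i j hij]
  have hsum : ∑ _i : Fin k, 2 ≤ ∑ i, (C i).card :=
    sum_le_sum fun i _ => (hdom i).two_le_card hE
  simp only [sum_const, card_univ, Fintype.card_fin, smul_eq_mul] at hsum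
  omega

end TotalEdgeDomatic

section Complement

variable {V : Type*} [Fintype V] [DecidableEq V] {E : Finset (Finset V)} {r : ℕ}

theorem card_eq_two_mul_card_filter_mem (hc : ∀ e ∈ E, eᶜ ∈ E) (x : V) :
    E.card = 2 * (E.filter (x ∈ ·)).card := by
  have h : (E.filter (x ∈ ·)).card = (E.filter (x ∉ ·)).card :=
    card_bij' (fun e _ => eᶜ) (fun e _ => eᶜ)
      (by simp +contextual [hc]) (by simp +contextual [hc]) (by simp) (by simp)
  rw [two_mul]
  nth_rw 2 [h]
  exact (card_filter_add_card_filter_not _).symm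

/-- Enumerate the edges through `x` cyclically as `a₀, a₁, …` and pair `aᵢ` with the complement
of `aᵢ₊₁`. -/
theorem exists_isTotalEdgeDomaticPartition (hV : Fintype.card V = 2 * r)
    (hE : ∀ e ∈ E, e.card = r) (hc : ∀ e ∈ E, eᶜ ∈ E) {x : V}
    (hx : 2 ≤ (E.filter (x ∈ ·)).card) :
    ∃ C : Fin (E.card / 2) → Finset (Finset V), IsTotalEdgeDomaticPartition E C := by
  have hm : E.card / 2 = (E.filter (x ∈ ·)).card := by
    rw [card_eq_two_mul_card_filter_mem hc x]
    omega
  rw [hm]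
  set A := E.filter (x ∈ ·) with hA
  let f : Fin A.card ≃ A := A.equivFin.symm
  let σ : Equiv.Perm (Fin A.card) := finRotate A.card
  have hσ : ∀ i, σ i ≠ i := fun i => by
    have : NeZero A.card := ⟨by omega⟩
    have : A.card ≠ 1 := by omega
    simpa [σ, finRotate_apply]
  have hfE : ∀ i, (f i : Finset V) ∈ E := fun i => (mem_filter.1 (f i).2).1
  have hfx : ∀ i, x ∈ (f i : Finset V) := fun i => (mem_filter.1 (f i).2).2
  have hinj : ∀ i j, (f i : Finset V) = f j ↔ i = j := fun i j => by
    rw [Subtype.coe_inj, f.apply_eq_iff_eq]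
  have hnc : ∀ i j, (f i : Finset V) ≠ (f j : Finset V)ᶜ := fun i j h => by
    have := hfx i
    rw [h, mem_compl] at this
    exact this (hfx j)
  refine ⟨fun i => {(f i : Finset V), (f (σ i) : Finset V)ᶜ}, ?_, ?_, fun i => ?_⟩
  · intro i j hij
    simp [hinj, hnc, (hnc _ _).symm, hij.symm]
  · ext e
    simp only [mem_biUnion, mem_univ, true_and, mem_insert, mem_singleton]
    constructor
    · rintro ⟨i, rfl | rfl⟩
      exacts [hfE i, hc _ (hfE _)]
    · intro he
      by_cases hxe : x ∈ e
      · exact ⟨f.symm ⟨e, by simp [hA, he, hxe]⟩, by simp⟩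
      · exact ⟨σ.symm (f.symm ⟨eᶜ, by simp [hA, hc e he, hxe]⟩), by simp⟩
  · refine isTotalEdgeDominatingSet_pair hV hE (hfE i) (hc _ (hfE _)) (hnc _ _) ?_
    rw [compl_compl, ne_eq, hinj]
    exact (hσ i).symm

end Complement

section Bipartite

variable {V : Type*} [DecidableEq V] {X Y : Finset V} {r : ℕ}

theorem compl_mem_bipEdges [Fintype V] (hdisj : Disjoint X Y) (hunion : X ∪ Y = univ)
    (hXr : X.card = r) (hYr : Y.card = r) {e : Finset V} (he : e ∈ bipEdges X Y r) :
    eᶜ ∈ bipEdges X Y r := by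
  have hV : Fintype.card V = 2 * r := by
    rw [← card_univ, ← hunion, card_union_of_disjoint hdisj]
    omega
  simp only [bipEdges, hunion, mem_filter, mem_powersetCard, subset_univ, true_and] at he ⊢
  obtain ⟨her, heX, heY⟩ := he
  have key : ∀ Z W : Finset V, Disjoint Z W → Z.card = r → (e ∩ W).Nonempty →
      (eᶜ ∩ Z).Nonempty := by
    intro Z W hZW hZ heW
    by_contra h
    rw [not_nonempty_iff_eq_empty, ← disjoint_iff_inter_eq_empty, disjoint_comm,
      disjoint_compl_right_iff] at h
    obtain rfl := eq_of_subset_of_card_le h (by omega)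
    exact heW.ne_empty (disjoint_iff_inter_eq_empty.1 hZW)
  exact ⟨by rw [card_compl]; omega, key X Y hdisj hXr heY, key Y X hdisj.symm hYr heX⟩

theorem exists_two_le_card_filter_mem_bipEdges (hdisj : Disjoint X Y)
    (hXr : X.card = r) (hYr : Y.card = r) (hr : 2 ≤ r) :
    ∃ x, 2 ≤ ((bipEdges X Y r).filter (x ∈ ·)).card := by
  obtain ⟨x, hx, z, hz, hxz⟩ := one_lt_card.1 (show 1 < X.card by omega)
  refine ⟨x, (hr.trans_eq hYr.symm).trans ?_⟩
  have hYX : ∀ y ∈ Y, y ∉ X := fun y hy hyX => disjoint_left.1 hdisj hyX hy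
  refine card_le_card_of_injOn (fun y => insert y (X.erase z)) ?_ ?_
  · intro y hy
    have hyX : y ∉ X.erase z := fun h => hYX y hy (mem_of_mem_erase h)
    have hxe : x ∈ insert y (X.erase z) := by simp [hx, hxz]
    simp only [bipEdges, coe_filter, mem_filter, mem_powersetCard, Set.mem_ofPred_eq]
    refine ⟨⟨⟨?_, ?_⟩, ⟨x, mem_inter.2 ⟨hxe, hx⟩⟩, ⟨y, by simpa using hy⟩⟩, hxe⟩
    · exact insert_subset (mem_union_right _ hy)
        ((erase_subset _ _).trans subset_union_left)
    · rw [card_insert_of_notMem hyX, card_erase_of_mem hz]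
      omega
  · intro y hy y' hy' h
    have : y ∈ insert y' (X.erase z) := by
      rw [← show insert y (X.erase z) = insert y' (X.erase z) from h]
      exact mem_insert_self y (X.erase z)
    exact (mem_insert.1 this).resolve_right fun h => hYX y hy (mem_of_mem_erase h)

end Bipartite

/-- a complete bipartite `r`-uniform hypergraph with `|X| = |Y| = r`,
`r ≥ 2`, has total edge-domatic number `|E|/2`. -/
theorem total_edge_domatic_number_bipartite_balanced {V : Type*} [Fintype V] [DecidableEq V]
    {X Y : Finset V} {r : ℕ}
    (hdisj : Disjoint X Y) (hX : X.Nonempty) (hY : Y.Nonempty)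
    (hunion : X ∪ Y = (Finset.univ : Finset V))
    (hXr : X.card = r) (hYr : Y.card = r) (hr2 : 2 ≤ r) :
    IsGreatest {k : ℕ | ∃ C : Fin k → Finset (Finset V),
      IsTotalEdgeDomaticPartition (bipEdges X Y r) C} ((bipEdges X Y r).card / 2) := by
  have hV : Fintype.card V = 2 * r := by
    rw [← card_univ, ← hunion, card_union_of_disjoint hdisj]
    omega
  obtain ⟨x, hx⟩ := exists_two_le_card_filter_mem_bipEdges hdisj hXr hYr hr2
  refine ⟨exists_isTotalEdgeDomaticPartition hV (fun e he => ?_)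
    (fun e he => compl_mem_bipEdges hdisj hunion hXr hYr he) hx, ?_⟩
  · exact (mem_powersetCard.1 (mem_filter.1 he).1).2
  · rintro k ⟨C, hC⟩
    exact hC.le_card_div_two
      ((card_pos.1 (zero_lt_two.trans_le hx)).mono (filter_subset _ _))
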